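/- Let n, c, k be integers with n-1 ≥ c ≥ 2k ≥ 4. Every 2-connected graph G of order n with circumference c and minimum degree at least k satisfies e(G) ≤ max{f(n,c,k), f(n,c,⌊c/2⌋)}, and this bound is attained by a 2-connected graph of order n, circumference c and minimum degree at least k. -/

import Mathlib

open SimpleGraph

/-- The degree of a vertex, as `Nat.card` of its neighbor set. -/
noncomputable def degN {V : Type*} (G : SimpleGraph V) (v : V) : ℕ :=
  Nat.card (G.neighborSet v)

/-- `G` has minimum degree exactly `k`. -/
def MinDegreeEq {V : Type*} (G : SimpleGraph V) (k : ℕ) : Prop :=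
  (∀ v, k ≤ degN G v) ∧ ∃ v, degN G v = k

/-- `G` is 2-connected: at least 3 vertices and deleting any vertex leaves a connected graph. -/
def TwoConnected {V : Type*} (G : SimpleGraph V) : Prop :=
  3 ≤ Nat.card V ∧ ∀ v : V, (G.induce {u | u ≠ v}).Connected

/-- The circumference of `G`: the length of a longest cycle (0 if there are none). -/
noncomputable def circ {V : Type*} (G : SimpleGraph V) : ℕ :=
  sSup {n | ∃ (v : V) (w : G.Walk v v), w.IsCycle ∧ w.length = n}

/-- The detour order of `G`: the number of vertices of a longest path. -/
noncomputable def detour {V : Type*} (G : SimpleGraph V) : ℕ :=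
  sSup {n | ∃ (u v : V) (p : G.Walk u v), p.IsPath ∧ p.length + 1 = n}

/-- The number of cliques of cardinality `s` in `G`. -/
noncomputable def cliquesN {V : Type*} (G : SimpleGraph V) (s : ℕ) : ℕ :=
  Nat.card {S : Finset V // G.IsNClique s S}

/-- The number of edges of `G`. -/
noncomputable def edgeCount {V : Type*} (G : SimpleGraph V) : ℕ :=
  Nat.card G.edgeSet

/-- `G` contains a Hamilton cycle. -/
def IsHamiltonianGr {V : Type*} (G : SimpleGraph V) : Prop :=
  ∃ (v : V) (w : G.Walk v v), w.IsCycle ∧ ∀ u : V, u ∈ w.support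

/-- `G` contains a Hamilton path. -/
def IsTraceableGr {V : Type*} (G : SimpleGraph V) : Prop :=
  ∃ (u v : V) (p : G.Walk u v), p.IsPath ∧ ∀ w : V, w ∈ p.support

/-- `f_s(n,c,k) = C(c+1-k, s) + (n-c-1+k)·C(k, s-1)`. -/
def fCliques (n c k s : ℕ) : ℕ :=
  Nat.choose (c + 1 - k) s + (n + k - c - 1) * Nat.choose k (s - 1)

/-- `g_s(n,c,k) = C(c+1-t, s) + (n-c-2+t)·C(t, s-1) + C(k, s-1)` with `t = ⌊c/2⌋`. -/
def gCliques (n c k s : ℕ) : ℕ :=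
  Nat.choose (c + 1 - c / 2) s + (n + c / 2 - c - 2) * Nat.choose (c / 2) (s - 1)
    + Nat.choose k (s - 1)

/-- `g_s(n,c,k,q) = q·C(k, s-1) + (n-q-c-1+t)·C(t, s-1) + C(c+1-t, s)` with `t = ⌊c/2⌋`. -/
def gCliquesQ (n c k q s : ℕ) : ℕ :=
  q * Nat.choose k (s - 1) + (n + c / 2 - q - c - 1) * Nat.choose (c / 2) (s - 1)
    + Nat.choose (c + 1 - c / 2) s

/-- `F(n,c,k) = K_k ∨ (K_{c+1-2k} + \overline{K_{n-c-1+k}})`, realized on `Fin n`: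
vertices `0,…,k-1` are the dominating clique `K_k`, vertices `k,…,c-k` extend it to
`K_{c+1-k}`, and vertices `c-k+1,…,n-1` form the independent part. -/
def Fgraph (n c k : ℕ) : SimpleGraph (Fin n) where
  Adj x y := x ≠ y ∧ (x.val < k ∨ y.val < k ∨ (x.val ≤ c - k ∧ y.val ≤ c - k))
  symm := ⟨by intro x y h; exact ⟨h.1.symm, by tauto⟩⟩
  loopless := ⟨by intro x h; exact h.1 rfl⟩

/-- `G(n,c,k)`: from `K_t ∨ (K_{c+1-2t} + \overline{K_{n-c-1+t}})` (with `t = ⌊c/2⌋`)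
delete `t-k` edges incident to one common vertex (the vertex `n-1`) of the independent
part, keeping only its `k` neighbors `0,…,k-1`. -/
def Ggraph (n c k : ℕ) : SimpleGraph (Fin n) :=
  (Fgraph n c (c / 2)).deleteEdges
    {e | ∃ x y : Fin n, e = s(x, y) ∧ x.val = n - 1 ∧ k ≤ y.val ∧ y.val < c / 2}


theorem exists_first {α : Type*} (p : α → Prop) :
    ∀ l : List α, (∃ x ∈ l, p x) → ∃ l1 b l2, l = l1 ++ b :: l2 ∧ p b ∧ ∀ y ∈ l1, ¬ p y := by
  intro l
  induction l with
  | nil => rintro ⟨x, hx, _⟩; simp at hx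
  | cons a l ih =>
    intro h
    by_cases ha : p a
    · exact ⟨[], a, l, by simp, ha, by simp⟩
    · obtain ⟨x, hx, hpx⟩ := h
      have : ∃ x ∈ l, p x := by
        rcases List.mem_cons.1 hx with rfl | hx
        · exact absurd hpx ha
        · exact ⟨x, hx, hpx⟩
      obtain ⟨l1, b, l2, rfl, hb, hl⟩ := ih this
      refine ⟨a :: l1, b, l2, by simp, hb, ?_⟩
      intro y hy
      rcases List.mem_cons.1 hy with rfl | hy
      · exact ha
      · exact hl y hy

theorem exists_last {α : Type*} (p : α → Prop) (l : List α) (h : ∃ x ∈ l, p x) :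
    ∃ l1 b l2, l = l1 ++ b :: l2 ∧ p b ∧ ∀ y ∈ l2, ¬ p y := by
  obtain ⟨l1, b, l2, e, hb, hl⟩ := exists_first p l.reverse (by simpa using h)
  refine ⟨l2.reverse, b, l1.reverse, ?_, hb, by simpa using hl⟩
  have := congrArg List.reverse e
  simpa using this

/-- In a 2-connected graph, a path linking two disjoint sets and avoiding a vertex. -/
theorem link {V : Type*} {G : SimpleGraph V} (hG : TwoConnected G) (v : V) (A B : Set V)
    (hAB : ∀ x ∈ A, x ∉ B) (a b : V) (ha : a ∈ A) (hav : a ≠ v) (hb : b ∈ B) (hbv : b ≠ v) :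
    ∃ a' mid b', a' ∈ A ∧ b' ∈ B ∧ List.IsChain G.Adj (a' :: mid ++ [b']) ∧
      (a' :: mid ++ [b']).Nodup ∧ v ∉ (a' :: mid ++ [b']) ∧ (∀ y ∈ mid, y ∉ A ∧ y ∉ B) := by
  classical
  have hc := hG.2 v
  obtain ⟨w⟩ := hc.preconnected ⟨a, hav⟩ ⟨b, hbv⟩
  obtain ⟨q, hq⟩ := w.toPath
  have hn := hq.support_nodup
  have hch := q.isChain_adj_support
  obtain ⟨l, hl⟩ : ∃ l, l = q.support.map Subtype.val := ⟨_, rfl⟩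
  have hl1 : l.Nodup := by
    rw [hl]; exact hn.map Subtype.val_injective
  have hl2 : l.IsChain G.Adj := by
    rw [hl, List.isChain_map]
    exact hch.imp (fun x y h => by simpa using h)
  have hl3 : v ∉ l := by
    rw [hl]; simp
  have hal : l.head? = some a := by
    rw [hl]; cases q <;> simp
  have hbl : b ∈ l := by
    rw [hl]; simp only [List.mem_map]; exact ⟨⟨b, hbv⟩, q.end_mem_support, rfl⟩
  clear hl hch hn
  obtain ⟨l1, b', l2, rfl, hb', hl1B⟩ := exists_first (· ∈ B) l ⟨b, hbl, hb⟩
  have hal1 : a ∈ l1 := by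
    cases l1 with
    | nil => simp at hal; subst hal; exact absurd hb' (hAB _ ha)
    | cons c l1 => simp at hal; simp [hal]
  obtain ⟨l3, a', mid, rfl, ha', hmA⟩ := exists_last (· ∈ A) l1 ⟨a, hal1, ha⟩
  have hinf : (a' :: mid ++ [b']) <:+: ((l3 ++ a' :: mid) ++ b' :: l2) := by
    refine ⟨l3, l2, by simp⟩
  refine ⟨a', mid, b', ha', hb', hl2.infix hinf, hl1.sublist hinf.sublist,
    fun h => hl3 (hinf.subset h), fun y hy => ⟨hmA y hy, hl1B y (by simp [hy])⟩⟩

/-- Sweeping state for the construction of two disjoint paths. -/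
def SwState {V : Type*} (G : SimpleGraph V) (X : Set V) (u v : V) (T : List V) : Prop :=
  ∃ (r1 : List V) (w : V) (r2 : List V) (s1 s2 : V),
    (v :: r1).Nodup ∧ (w :: r2).Nodup ∧ (∀ y ∈ v :: r1, y ∉ w :: r2) ∧
    (v :: r1).IsChain G.Adj ∧ (w :: r2).IsChain G.Adj ∧
    w ∈ T ∧ (∀ y ∈ v :: r1, y ∉ T) ∧ (∀ y ∈ r2, y ∉ T) ∧
    (v :: r1).getLast? = some s1 ∧ (w :: r2).getLast? = some s2 ∧ s1 ∈ X ∧ s2 ∈ X ∧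
    (∀ y ∈ v :: r1, y ∈ X → y = s1) ∧ (∀ y ∈ w :: r2, y ∈ X → y = s2) ∧ (s1 = u ∨ s2 = u)

theorem sw_base {V : Type*} {G : SimpleGraph V} (hG : TwoConnected G) (X : Set V) (u x : V)
    (T : List V) (hu : u ∈ X) (hx : x ∈ X) (hxu : x ≠ u) (hT : T ≠ [])
    (hXT : ∀ y ∈ X, y ∉ T) : SwState G X u u T := by
  obtain ⟨t, ht⟩ := List.exists_mem_of_ne_nil T hT
  obtain ⟨w, mid, s, hw, hs, hc, hn, hv, hm⟩ := link hG u {y | y ∈ T} X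
    (fun y hy hyX => hXT y hyX hy) t x ht (by rintro rfl; exact hXT _ hu ht) hx hxu
  refine ⟨[], w, mid ++ [s], u, s, by simp, by simpa using hn, ?_, by simp, by simpa using hc, hw,
    ?_, ?_, by simp, by rw [← List.cons_append, List.getLast?_concat], hu, hs, by simp, ?_, by simp⟩
  · simpa using hv
  · simpa using hXT u hu
  · intro y hy
    simp at hy
    rcases hy with hy | rfl
    · exact (hm y hy).1
    · exact hXT _ hs
  · intro y hy hyX
    simp at hy
    rcases hy with rfl | hy | rfl
    · exact absurd hw (hXT _ hyX)
    · exact absurd hyX (hm y hy).2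
    · rfl

theorem sw_step {V : Type*} {G : SimpleGraph V} (hG : TwoConnected G) (X : Set V) (u v w' : V)
    (T : List V) (hT : T ≠ []) (hXT : ∀ y ∈ X, y ∉ w' :: T) (hvw : G.Adj v w')
    (hn : (w' :: T).Nodup) (h : SwState G X u v (w' :: T)) : SwState G X u w' T := by
  obtain ⟨r1, w, r2, s1, s2, n1, n2, dj, c1, c2, hwT, h1T, h2T, l1, l2, s1X, s2X, x1, x2, hu⟩ := h
  have hw'T : w' ∉ T := (List.nodup_cons.1 hn).1
  by_cases hww : w = w'
  · subst hww
    obtain ⟨t, ht⟩ := List.exists_mem_of_ne_nil T hT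
    obtain ⟨z0, mid, z, hz0, hz, hc, hnq, hv, hm⟩ := link hG w {y | y ∈ T}
      {y | y ∈ X ∨ y ∈ v :: r1 ∨ y ∈ r2} (by
        rintro y hy (h | h | h)
        · exact hXT y h (List.mem_cons_of_mem _ hy)
        · exact h1T y h (List.mem_cons_of_mem _ hy)
        · exact h2T y h (List.mem_cons_of_mem _ hy)) t v ht
        (by rintro rfl; exact hw'T ht) (by simp) (by rintro rfl; exact dj v (by simp) (by simp))
    simp only [Set.mem_ofPred_eq, not_or] at hm hz hz0
    by_cases hz1 : z ∈ v :: r1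
    · -- z on the first path
      obtain ⟨a, b, hab⟩ := List.append_of_mem hz1
      have hsub : ∀ y ∈ z :: b, y ∈ v :: r1 := by
        intro y hy; rw [hab]; exact List.mem_append_right _ hy
      refine ⟨r2, z0, mid ++ z :: b, s2, s1, n2, ?_, ?_, c2, ?_, hz0, ?_, ?_, l2, ?_, s2X, s1X,
        x2, ?_, hu.symm⟩
      · have hzb : (z :: b).Nodup := by
          rw [hab] at n1; exact n1.of_append_right
        grind
      · grind
      · have : (z :: b).IsChain G.Adj := by rw [hab] at c1; exact c1.right_of_append
        have := List.isChain_split.2 ⟨hc, this⟩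
        simpa using this
      · grind
      · grind
      · rw [← l1, hab, ← List.cons_append, List.getLast?_append_cons, List.getLast?_append_cons]
      · grind
    · by_cases hz2 : z ∈ r2
      · obtain ⟨a, b, hab⟩ := List.append_of_mem hz2
        have hsub : ∀ y ∈ z :: b, y ∈ r2 := by
          intro y hy; rw [hab]; exact List.mem_append_right _ hy
        have hzb : (z :: b).Nodup := by
          have := (List.nodup_cons.1 n2).2
          rw [hab] at this; exact this.of_append_right
        refine ⟨v :: r1, z0, mid ++ z :: b, s1, s2, ?_, ?_, ?_, ?_, ?_, hz0, ?_, ?_, ?_, ?_, s1X, s2X,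
          ?_, ?_, hu⟩
        · grind
        · grind
        · grind
        · simp only [List.isChain_cons_cons]; exact ⟨hvw.symm, c1⟩
        · have : (z :: b).IsChain G.Adj := by
            have := c2.tail
            simp only [List.tail_cons] at this
            rw [hab] at this; exact this.right_of_append
          have := List.isChain_split.2 ⟨hc, this⟩
          simpa using this
        · grind
        · grind
        · simpa using l1
        · rw [← l2, hab, ← List.cons_append, ← List.cons_append, List.getLast?_append_cons, List.getLast?_append_cons]
        · grind
        · grind
      · have hzX : z ∈ X := by tauto
        rcases hu with rfl | rfl
        · refine ⟨v :: r1, z0, mid ++ [z], s1, z, ?_, ?_, ?_, ?_, ?_, hz0, ?_, ?_, ?_, ?_, s1X, hzX,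
            ?_, ?_, Or.inl rfl⟩
          · grind
          · grind
          · grind
          · simp only [List.isChain_cons_cons]; exact ⟨hvw.symm, c1⟩
          · simpa using hc
          · grind
          · grind
          · simpa using l1
          · rw [← List.cons_append, List.getLast?_concat]
          · grind
          · grind
        · refine ⟨r2, z0, mid ++ [z], s2, z, ?_, ?_, ?_, ?_, ?_, hz0, ?_, ?_, ?_, ?_, s2X, hzX,
            ?_, ?_, Or.inl rfl⟩
          · grind
          · grind
          · grind
          · exact c2
          · simpa using hc
          · grind
          · grind
          · simpa using l2
          · rw [← List.cons_append, List.getLast?_concat]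
          · grind
          · grind
  · refine ⟨v :: r1, w, r2, s1, s2, ?_, n2, ?_, ?_, c2, ?_, ?_, ?_, ?_, l2, s1X, s2X, ?_, x2, hu⟩
    · grind
    · grind
    · simp only [List.isChain_cons_cons]; exact ⟨hvw.symm, c1⟩
    · grind
    · grind
    · grind
    · simpa using l1
    · grind

theorem sw_iter {V : Type*} {G : SimpleGraph V} (hG : TwoConnected G) (X : Set V) (u : V) (T : List V)
    (hT : T ≠ []) : ∀ (M : List V) (v v' : V), (M ++ T).Nodup → (∀ y ∈ X, y ∉ M ++ T) →
    (v :: M).IsChain G.Adj → (v :: M).getLast? = some v' →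
    SwState G X u v (M ++ T) → SwState G X u v' T := by
  intro M
  induction M with
  | nil => intro v v' _ _ _ h; simp at h; subst h; simp
  | cons w M ih =>
    intro v v' hn hX hc hl hs
    simp only [List.isChain_cons_cons] at hc
    refine ih w v' (List.nodup_cons.1 hn).2 (fun y hy h => hX y hy (by simp at h ⊢; tauto)) hc.2
      (by simpa using hl) ?_
    exact sw_step hG X u v w (M ++ T) (by simp [hT]) hX hc.1 hn hs


/-- `l` is the list of vertices of a closed walk (started after its base point, ending at it)
without repetition. -/
def LCyc {V : Type*} (G : SimpleGraph V) (l : List V) : Prop :=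
  ∃ s, (s :: l).IsChain G.Adj ∧ l.getLast? = some s ∧ l.Nodup

/-- The segment `p a, …, p b`. -/
def seg {V : Type*} (p : ℕ → V) (a b : ℕ) : List V := (List.range' a (b + 1 - a)).map p

theorem seg_mem {V : Type*} (p : ℕ → V) (a b : ℕ) (z : V) :
    z ∈ seg p a b ↔ ∃ i, a ≤ i ∧ i ≤ b ∧ p i = z := by
  simp only [seg, List.mem_map, List.mem_range'_1]
  constructor
  · rintro ⟨i, h, rfl⟩; exact ⟨i, by omega, by omega, rfl⟩
  · rintro ⟨i, h, h', rfl⟩; exact ⟨i, by omega, rfl⟩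

theorem seg_length {V : Type*} (p : ℕ → V) (a b : ℕ) : (seg p a b).length = b + 1 - a := by
  simp [seg]

theorem seg_cons {V : Type*} (p : ℕ → V) {a b : ℕ} (h : a ≤ b) :
    seg p a b = p a :: seg p (a + 1) b := by
  obtain ⟨k, rfl⟩ := Nat.exists_eq_add_of_le h
  have e1 : a + k + 1 - a = k + 1 := by omega
  have e2 : a + k + 1 - (a + 1) = k := by omega
  simp [seg, e1, e2, List.range'_succ]

theorem seg_append {V : Type*} (p : ℕ → V) {a b c : ℕ} (h : a ≤ b + 1) (h' : b ≤ c) :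
    seg p a b ++ seg p (b + 1) c = seg p a c := by
  obtain ⟨k, hk⟩ := Nat.exists_eq_add_of_le h
  obtain ⟨j, rfl⟩ := Nat.exists_eq_add_of_le h'
  have e1 : b + 1 - a = k := by omega
  have e2 : b + j + 1 - (b + 1) = j := by omega
  have e3 : b + j + 1 - a = k + j := by omega
  simp only [seg, e1, e2, e3, ← List.map_append]
  rw [hk, List.range'_append_1]

theorem seg_head {V : Type*} (p : ℕ → V) {a b : ℕ} (h : a ≤ b) : (seg p a b).head? = some (p a) := by
  rw [seg_cons p h]; rfl

theorem seg_last {V : Type*} (p : ℕ → V) {a b : ℕ} (h : a ≤ b) :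
    (seg p a b).getLast? = some (p b) := by
  rcases Nat.eq_or_lt_of_le h with rfl | h
  · simp [seg]
  · obtain ⟨k, rfl⟩ : ∃ k, b = k + 1 := ⟨b - 1, by omega⟩
    rw [← seg_append p (b := k) (by omega) (by omega)]
    have : seg p (k + 1) (k + 1) = [p (k + 1)] := by simp [seg]
    rw [this, List.getLast?_concat]

theorem seg_chain {V : Type*} {G : SimpleGraph V} {p : ℕ → V} {m : ℕ}
    (hadj : ∀ i < m, G.Adj (p i) (p (i + 1))) (a b : ℕ) (h : b ≤ m) :
    (seg p a b).IsChain G.Adj := by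
  rw [List.isChain_iff_getElem]
  intro i hi
  rw [seg_length] at hi
  simp only [seg, List.getElem_map, List.getElem_range']
  have := hadj (a + i) (by omega)
  simpa [add_assoc] using this

theorem seg_nodup {V : Type*} {p : ℕ → V} {m : ℕ} (hinj : Set.InjOn p (Set.Iic m)) (a b : ℕ)
    (h : b ≤ m) : (seg p a b).Nodup := by
  refine List.Nodup.map_on ?_ (List.nodup_range')
  intro x hx y hy hxy
  simp only [List.mem_range'_1] at hx hy
  exact hinj (by simp; omega) (by simp; omega) hxy

theorem chain_rev {V : Type*} {G : SimpleGraph V} {l : List V} (h : l.IsChain G.Adj) :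
    l.reverse.IsChain G.Adj := by
  rw [List.isChain_reverse]
  exact h.imp (fun a b h => h.symm)

theorem list_ends {V : Type*} {l : List V} {s t : V} (hs : l.head? = some s)
    (ht : l.getLast? = some t) (hst : s ≠ t) : ∃ m, l = s :: m ++ [t] := by
  cases l with
  | nil => simp at hs
  | cons a l =>
    simp at hs; subst hs
    rcases List.eq_nil_or_concat l with rfl | ⟨l', b, rfl⟩
    · simp at ht; exact absurd ht hst
    · refine ⟨l', ?_⟩
      rw [List.concat_eq_append, ← List.cons_append, List.getLast?_concat] at ht
      simp at ht; subst ht; simp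

theorem cross_cycle {V : Type*} {G : SimpleGraph V} {p : ℕ → V} {m : ℕ}
    (hinj : Set.InjOn p (Set.Iic m)) (hadj : ∀ i < m, G.Adj (p i) (p (i + 1)))
    {i j : ℕ} (hij : i < j) (hj : j ≤ m) (hx : G.Adj (p 0) (p j)) (hy : G.Adj (p m) (p i)) :
    ∃ l, LCyc G l ∧ l.length = (i + 1) + (m + 1 - j) := by
  refine ⟨seg p 0 i ++ (seg p j m).reverse, ⟨p j, ?_, ?_, ?_⟩, ?_⟩
  · rw [List.isChain_cons, List.isChain_append]
    refine ⟨?_, seg_chain hadj _ _ (by omega), chain_rev (seg_chain hadj _ _ le_rfl), ?_⟩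
    · rw [seg_cons p (Nat.zero_le i)]
      simpa using hx.symm
    · rw [seg_last p (Nat.zero_le i), List.head?_reverse, seg_last p hj]
      simpa using hy.symm
  · rw [seg_cons p hj]
    simp only [List.reverse_cons]
    rw [← List.append_assoc, List.getLast?_concat]
  · rw [List.nodup_append]
    refine ⟨seg_nodup hinj _ _ (by omega), List.nodup_reverse.2 (seg_nodup hinj _ _ le_rfl), ?_⟩
    intro a ha b hb
    rw [List.mem_reverse] at hb
    rw [seg_mem] at ha hb
    obtain ⟨i1, _, h1, rfl⟩ := ha
    obtain ⟨i2, h2, h3, rfl⟩ := hb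
    intro h
    have := hinj (by simp; omega) (by simp; omega) h
    omega
  · simp [seg_length]

theorem assemble {V : Type*} {G : SimpleGraph V} {X : Set V} {T : List V}
    (hXT : ∀ y ∈ X, y ∉ T)
    {v w s1 s2 : V} {r1 r2 mX mY : List V}
    (n1 : (v :: r1).Nodup) (n2 : (w :: r2).Nodup) (dj : ∀ y ∈ v :: r1, y ∉ w :: r2)
    (c1 : (v :: r1).IsChain G.Adj) (c2 : (w :: r2).IsChain G.Adj)
    (hwT : w ∈ T) (h1T : ∀ y ∈ v :: r1, y ∉ T) (h2T : ∀ y ∈ r2, y ∉ T)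
    (l1 : (v :: r1).getLast? = some s1) (l2 : (w :: r2).getLast? = some s2)
    (s2X : s2 ∈ X)
    (x1 : ∀ y ∈ v :: r1, y ∈ X → y = s1) (x2 : ∀ y ∈ w :: r2, y ∈ X → y = s2)
    (cX : (s1 :: mX ++ [s2]).IsChain G.Adj) (nX : (s1 :: mX ++ [s2]).Nodup)
    (hX : ∀ y ∈ mX, y ∈ X)
    (cY : (v :: mY ++ [w]).IsChain G.Adj) (nY : (v :: mY ++ [w]).Nodup)
    (hY : ∀ y ∈ mY, y ∈ T) :
    ∃ l, LCyc G l ∧ mX.length + mY.length + 3 ≤ l.length := by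
  have hws : w ≠ s2 := by rintro rfl; exact hXT _ s2X hwT
  obtain ⟨r2', hr2⟩ := list_ends (l := w :: r2) (by simp) l2 hws
  have hr : r2 = r2' ++ [s2] := by simpa using hr2
  subst hr
  refine ⟨mX ++ s2 :: (r2'.reverse ++ w :: (mY.reverse ++ v :: r1)), ⟨s1, ?_, ?_, ?_⟩, ?_⟩
  · rw [← List.cons_append, List.isChain_split]
    refine ⟨cX, ?_⟩
    rw [← List.cons_append, List.isChain_split]
    refine ⟨by simpa using chain_rev c2, ?_⟩
    rw [← List.cons_append, List.isChain_split]
    exact ⟨by simpa using chain_rev cY, c1⟩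
  · rw [List.getLast?_append_cons, ← List.cons_append, List.getLast?_append_cons,
      ← List.cons_append, List.getLast?_append_cons, l1]
  · have s2r : s2 ∉ r2' := by grind
    have mX2 : s2 ∉ mX := by grind
    have mX1 : s1 ∉ mX := by grind
    have h3 : ∀ y ∈ r2', y ∉ X := by
      intro y hy hyX
      have := x2 y (by simp [hy]) hyX
      subst this; exact s2r hy
    clear cX cY c1 c2 l1 l2 hr2
    simp only [List.nodup_append, List.nodup_cons, List.mem_append, List.mem_cons,
      List.mem_reverse, List.nodup_reverse] at *
    grind
  · simp; omega

open Classical in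
theorem kop {V : Type*} {G : SimpleGraph V} (hG : TwoConnected G) (p : ℕ → V) (m : ℕ) (hm : 1 ≤ m)
    (hinj : Set.InjOn p (Set.Iic m)) (hadj : ∀ i < m, G.Adj (p i) (p (i + 1)))
    (Nx Ny : Finset ℕ) (hNx : Nx = (Finset.Icc 1 m).filter (fun i => G.Adj (p 0) (p i)))
    (hNy : Ny = (Finset.range m).filter (fun i => G.Adj (p m) (p i))) :
    ∃ l, LCyc G l ∧ min (m + 1) (Nx.card + Ny.card) ≤ l.length := by
  have mx : ∀ i, i ∈ Nx ↔ (1 ≤ i ∧ i ≤ m) ∧ G.Adj (p 0) (p i) := by simp [hNx]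
  have my : ∀ i, i ∈ Ny ↔ i < m ∧ G.Adj (p m) (p i) := by simp [hNy]
  by_cases hcr : ∃ d i, i ∈ Ny ∧ i + d + 1 ∈ Nx
  · obtain ⟨d, ⟨i, hi, hj⟩, hmin⟩ : ∃ d, (∃ i, i ∈ Ny ∧ i + d + 1 ∈ Nx) ∧
        ∀ d' < d, ¬ ∃ i, i ∈ Ny ∧ i + d' + 1 ∈ Nx :=
      ⟨Nat.find hcr, Nat.find_spec hcr, fun _ h => Nat.find_min hcr h⟩
    have hi' := (my i).1 hi
    have hj' := (mx _).1 hj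
    obtain ⟨l, hl, hlen⟩ := cross_cycle hinj hadj (i := i) (j := i + d + 1) (by omega) hj'.1.2
      hj'.2 hi'.2
    refine ⟨l, hl, ?_⟩
    rw [hlen]
    rcases Nat.eq_zero_or_pos d with rfl | hd
    · exact (min_le_left _ _).trans (by omega)
    · refine (min_le_right _ _).trans ?_
      have e : Nx.card = (Nx.image (fun i => i - 1)).card := by
        rw [Finset.card_image_of_injOn]
        intro a ha b hb hab
        have := (mx a).1 ha
        have := (mx b).1 hb
        simp at hab; omega
      have hdis : Disjoint (Nx.image (fun i => i - 1)) Ny := by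
        rw [Finset.disjoint_left]
        intro a ha hb
        obtain ⟨b, hb', rfl⟩ := Finset.mem_image.1 ha
        have := (mx b).1 hb'
        refine hmin _ hd ⟨b - 1, hb, ?_⟩
        have : b - 1 + 0 + 1 = b := by omega
        rwa [this]
      rw [e, ← Finset.card_union_of_disjoint hdis]
      have hsub : Nx.image (fun i => i - 1) ∪ Ny ⊆ Finset.Icc 0 i ∪ Finset.Ico (i + d) m := by
        intro a ha
        rw [Finset.mem_union] at ha
        simp only [Finset.mem_union, Finset.mem_Icc, Finset.mem_Ico]
        rcases ha with ha | ha
        · obtain ⟨b, hb, rfl⟩ := Finset.mem_image.1 ha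
          have h1 := (mx b).1 hb
          by_contra hcon
          refine hmin (b - i - 1) (by omega) ⟨i, hi, ?_⟩
          have : i + (b - i - 1) + 1 = b := by omega
          rwa [this]
        · have h1 := (my a).1 ha
          by_contra hcon
          refine hmin (d + i - a) (by omega) ⟨a, ha, ?_⟩
          have : a + (d + i - a) + 1 = i + d + 1 := by omega
          rwa [this]
      refine (Finset.card_le_card hsub).trans ((Finset.card_union_le _ _).trans ?_)
      simp
  · push Not at hcr
    have hnc : ∀ i ∈ Ny, ∀ j ∈ Nx, j ≤ i := by
      intro i hi j hj
      by_contra h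
      refine hcr (j - i - 1) i hi ?_
      have : i + (j - i - 1) + 1 = j := by omega
      rwa [this]
    clear hcr
    have hNx1 : Nx.Nonempty := ⟨1, (mx 1).2 ⟨by omega, hadj 0 (by omega)⟩⟩
    have hNy1 : Ny.Nonempty := ⟨m - 1, (my _).2 ⟨by omega, by
      have := hadj (m - 1) (by omega)
      rw [Nat.sub_add_cancel hm] at this
      exact this.symm⟩⟩
    obtain ⟨a, haN, hamax⟩ : ∃ a ∈ Nx, ∀ i ∈ Nx, i ≤ a :=
      ⟨Nx.max' hNx1, Nx.max'_mem _, fun i hi => Nx.le_max' i hi⟩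
    obtain ⟨b, hbN, hbmin⟩ : ∃ b ∈ Ny, ∀ i ∈ Ny, b ≤ i :=
      ⟨Ny.min' hNy1, Ny.min'_mem _, fun i hi => Ny.min'_le i hi⟩
    have hab : a ≤ b := hnc b hbN a haN
    have ha := (mx a).1 haN
    have hb := (my b).1 hbN
    have hinj' : ∀ i j, i ≤ m → j ≤ m → p i = p j → i = j := fun i j h1 h2 h => hinj h1 h2 h
    let X : Set V := {z | ∃ i, i ≤ a ∧ p i = z}
    let T := seg p (b + 1) m
    have hXT' : ∀ y ∈ X, y ∉ seg p (a + 1) m := by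
      rintro y ⟨i, hi, rfl⟩ hy
      rw [seg_mem] at hy
      obtain ⟨j, h1, h2, h3⟩ := hy
      have := hinj' j i h2 (by omega) h3
      omega
    have hMT : seg p (a + 1) b ++ T = seg p (a + 1) m := seg_append p (by omega) (by omega)
    have hXT : ∀ y ∈ X, y ∉ T := by
      intro y hy h
      refine hXT' y hy ?_
      rw [← hMT]; exact List.mem_append_right _ h
    have hTne : T ≠ [] := by
      show seg p (b + 1) m ≠ []
      rw [seg_cons p (by omega)]; simp
    have hst : SwState G X (p a) (p b) T := by
      refine sw_iter hG X (p a) T hTne (seg p (a + 1) b) (p a) (p b) ?_ ?_ ?_ ?_ ?_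
      · rw [hMT]; exact seg_nodup hinj _ _ le_rfl
      · rw [hMT]; exact hXT'
      · rw [← seg_cons p hab]; exact seg_chain hadj _ _ (by omega)
      · rw [← seg_cons p hab]; exact seg_last p hab
      · rw [hMT]
        refine sw_base hG X (p a) (p 0) _ ⟨a, le_rfl, rfl⟩ ⟨0, by omega, rfl⟩ ?_ ?_ hXT'
        · intro h; have := hinj' _ _ (by omega) (by omega) h; omega
        · rw [seg_cons p (by omega)]; simp
    obtain ⟨r1, w, r2, s1, s2, n1, n2, dj, c1, c2, hwT, h1T, h2T, l1, l2, s1X, s2X, x1, x2, hu⟩ := hst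
    have hs12 : s1 ≠ s2 := by
      rintro rfl
      exact dj s1 (List.mem_of_getLast? l1) (List.mem_of_getLast? l2)
    -- the X-side
    have hXside : ∀ e < a, ∃ L : List V, L.IsChain G.Adj ∧ L.Nodup ∧ L.head? = some (p e) ∧
        L.getLast? = some (p a) ∧ (∀ y ∈ L, y ∈ X) ∧ Nx.card + 1 ≤ L.length := by
      intro e he
      have hex : ∃ q, e < q ∧ q ∈ Nx := ⟨a, he, haN⟩
      obtain ⟨q, ⟨hq1, hq2⟩, hqmin⟩ : ∃ q, (e < q ∧ q ∈ Nx) ∧ ∀ q' < q, ¬ (e < q' ∧ q' ∈ Nx) :=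
        ⟨Nat.find hex, Nat.find_spec hex, fun _ h => Nat.find_min hex h⟩
      have hq3 := (mx q).1 hq2
      have hqa := hamax q hq2
      refine ⟨(seg p 0 e).reverse ++ seg p q a, ?_, ?_, ?_, ?_, ?_, ?_⟩
      · rw [List.isChain_append]
        refine ⟨chain_rev (seg_chain hadj _ _ (by omega)), seg_chain hadj _ _ (by omega), ?_⟩
        rw [List.getLast?_reverse, seg_head p (Nat.zero_le e), seg_head p hqa]
        simpa using hq3.2
      · rw [List.nodup_append]
        refine ⟨List.nodup_reverse.2 (seg_nodup hinj _ _ (by omega)), seg_nodup hinj _ _ (by omega), ?_⟩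
        intro y hy z hz h
        rw [List.mem_reverse] at hy
        rw [seg_mem] at hy hz
        obtain ⟨i1, _, h1, rfl⟩ := hy
        obtain ⟨i2, h2, h3, rfl⟩ := hz
        have := hinj' _ _ (by omega) (by omega) h
        omega
      · rw [List.head?_append, List.head?_reverse, seg_last p (Nat.zero_le e)]; rfl
      · rw [List.getLast?_append, seg_last p hqa]; rfl
      · intro y hy
        rw [List.mem_append, List.mem_reverse, seg_mem, seg_mem] at hy
        rcases hy with ⟨i, h1, h2, rfl⟩ | ⟨i, h1, h2, rfl⟩
        · exact ⟨i, by omega, rfl⟩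
        · exact ⟨i, by omega, rfl⟩
      · have hsub : Nx ⊆ Finset.Icc 1 e ∪ Finset.Icc q a := by
          intro i hi
          have h1 := (mx i).1 hi
          have h2 := hamax i hi
          simp only [Finset.mem_union, Finset.mem_Icc]
          by_contra hcon
          exact hqmin i (by omega) ⟨by omega, hi⟩
        have := (Finset.card_le_card hsub).trans (Finset.card_union_le _ _)
        simp at this
        simp [seg_length]; omega
    have hX2 : ∃ mX : List V, (s1 :: mX ++ [s2]).IsChain G.Adj ∧ (s1 :: mX ++ [s2]).Nodup ∧
        (∀ y ∈ mX, y ∈ X) ∧ Nx.card ≤ mX.length + 1 := by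
      rcases hu with rfl | rfl
      · obtain ⟨e, he, rfl⟩ := s2X
        have hea : e ≠ a := by rintro rfl; exact hs12 rfl
        obtain ⟨L, h1, h2, h3, h4, h5, h6⟩ := hXside e (by omega)
        obtain ⟨mX, rfl⟩ := list_ends h3 h4 hs12.symm
        refine ⟨mX.reverse, by simpa using chain_rev h1, ?_, ?_, ?_⟩
        · have := List.nodup_reverse.2 h2
          simpa using this
        · intro y hy; exact h5 y (by simp at hy ⊢; tauto)
        · simp at h6 ⊢; omega
      · obtain ⟨e, he, rfl⟩ := s1X
        have hea : e ≠ a := by rintro rfl; exact hs12 rfl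
        obtain ⟨L, h1, h2, h3, h4, h5, h6⟩ := hXside e (by omega)
        obtain ⟨mX, rfl⟩ := list_ends h3 h4 hs12
        refine ⟨mX, h1, h2, ?_, ?_⟩
        · intro y hy; exact h5 y (by simp; tauto)
        · simp at h6 ⊢; omega
    -- the Y-side
    have hY2 : ∃ mY : List V, (p b :: mY ++ [w]).IsChain G.Adj ∧ (p b :: mY ++ [w]).Nodup ∧
        (∀ y ∈ mY, y ∈ T) ∧ Ny.card ≤ mY.length + 1 := by
      obtain ⟨j, hj1, hj2, rfl⟩ := (seg_mem _ _ _ _).1 hwT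
      obtain ⟨q, hq, hqmax⟩ : ∃ q ∈ Ny.filter (· < j), ∀ i ∈ Ny.filter (· < j), i ≤ q := by
        have hne : (Ny.filter (· < j)).Nonempty := ⟨b, by simp [hbN]; omega⟩
        exact ⟨_, Finset.max'_mem _ hne, fun i hi => Finset.le_max' _ i hi⟩
      rw [Finset.mem_filter] at hq
      have hbq := hbmin q hq.1
      have hq3 := (my q).1 hq.1
      have hne : p b ≠ p j := by
        intro h; have := hinj' _ _ (by omega) (by omega) h; omega
      have hch : (seg p b q ++ (seg p j m).reverse).IsChain G.Adj := by
        rw [List.isChain_append]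
        refine ⟨seg_chain hadj _ _ (by omega), chain_rev (seg_chain hadj _ _ (by omega)), ?_⟩
        rw [List.head?_reverse, seg_last p hbq, seg_last p hj2]
        simpa using hq3.2.symm
      have hnd : (seg p b q ++ (seg p j m).reverse).Nodup := by
        rw [List.nodup_append]
        refine ⟨seg_nodup hinj _ _ (by omega), List.nodup_reverse.2 (seg_nodup hinj _ _ (by omega)), ?_⟩
        intro y hy z hz h
        rw [List.mem_reverse] at hz
        rw [seg_mem] at hy hz
        obtain ⟨i1, _, h1, rfl⟩ := hy
        obtain ⟨i2, h2, h3, rfl⟩ := hz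
        have := hinj' _ _ (by omega) (by omega) h
        omega
      have hsub : Ny ⊆ Finset.Icc b q ∪ Finset.Ico j m := by
        intro i hi
        have h1 := (my i).1 hi
        have h2 := hbmin i hi
        simp only [Finset.mem_union, Finset.mem_Icc, Finset.mem_Ico]
        by_contra hcon
        have := hqmax i (by rw [Finset.mem_filter]; exact ⟨hi, by omega⟩)
        omega
      have hcard := (Finset.card_le_card hsub).trans (Finset.card_union_le _ _)
      simp at hcard
      have hlen : (seg p b q ++ (seg p j m).reverse).length = (q + 1 - b) + (m + 1 - j) := by
        simp [seg_length]
      obtain ⟨mY, hmY⟩ := list_ends (l := seg p b q ++ (seg p j m).reverse) (s := p b) (t := p j)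
        (by rw [List.head?_append, seg_head p hbq]; rfl)
        (by rw [List.getLast?_append, List.getLast?_reverse, seg_head p hj2]; rfl) hne
      rw [hmY] at hch hnd hlen
      refine ⟨mY, hch, hnd, ?_, ?_⟩
      · intro y hy
        have hyb : y ≠ p b := by
          rintro rfl
          simp at hnd; tauto
        have hmem : y ∈ seg p b q ++ (seg p j m).reverse := by rw [hmY]; simp; tauto
        rw [List.mem_append, List.mem_reverse, seg_mem, seg_mem] at hmem
        show y ∈ seg p (b + 1) m
        rw [seg_mem]
        rcases hmem with ⟨i, h1, h2, rfl⟩ | ⟨i, h1, h2, rfl⟩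
        · refine ⟨i, ?_, by omega, rfl⟩
          rcases Nat.eq_or_lt_of_le h1 with rfl | h1
          · exact absurd rfl hyb
          · omega
        · exact ⟨i, by omega, by omega, rfl⟩
      · simp at hlen; omega
    obtain ⟨mX, cX, nX, hX, dX⟩ := hX2
    obtain ⟨mY, cY, nY, hY, dY⟩ := hY2
    obtain ⟨l, hl, hlen⟩ := assemble hXT n1 n2 dj c1 c2 hwT h1T h2T l1 l2 s2X x1 x2 cX nX hX cY nY hY
    exact ⟨l, hl, (min_le_right _ _).trans (by omega)⟩

/-- List version of Kopylov's lemma. -/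
theorem kop_list {V : Type*} {G : SimpleGraph V} (hG : TwoConnected G) (P : List V) (x y : V)
    (hP2 : 2 ≤ P.length) (hc : P.IsChain G.Adj) (hn : P.Nodup) (hx : P.head? = some x)
    (hy : P.getLast? = some y) (A B : Finset V) (hA : ∀ z ∈ A, z ∈ P ∧ G.Adj x z)
    (hB : ∀ z ∈ B, z ∈ P ∧ G.Adj y z) :
    ∃ l, LCyc G l ∧ min P.length (A.card + B.card) ≤ l.length := by
  classical
  obtain ⟨m, hm⟩ : ∃ m, P.length = m + 1 := ⟨P.length - 1, by omega⟩
  let p : ℕ → V := fun i => P.getD i x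
  have hp : ∀ i (hi : i < P.length), p i = P[i] := by
    intro i hi; simp [p, hi]
  have hp0 : p 0 = x := by
    cases P with
    | nil => simp at hm
    | cons a P => simp at hx; simp [p, hx]
  have hpm : p m = y := by
    rw [hp m (by omega)]
    rw [List.getLast?_eq_getElem?] at hy
    have : P.length - 1 = m := by omega
    rw [this, List.getElem?_eq_getElem (by omega)] at hy
    exact Option.some.inj hy
  have hinj : Set.InjOn p (Set.Iic m) := by
    intro i hi j hj hij
    simp at hi hj
    rw [hp i (by omega), hp j (by omega)] at hij
    exact (List.Nodup.getElem_inj_iff hn).1 hij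
  obtain ⟨l, hl, hlen⟩ := kop hG p m (by omega) hinj (by
    intro i hi
    rw [hp i (by omega), hp (i + 1) (by omega)]
    exact List.isChain_iff_getElem.1 hc i (by omega)) _ _ rfl rfl
  refine ⟨l, hl, le_trans ?_ hlen⟩
  rw [hm]
  have key : ∀ z ∈ P, ∃ i, i ≤ m ∧ p i = z := by
    intro z hz
    obtain ⟨i, hi, rfl⟩ := List.getElem_of_mem hz
    exact ⟨i, by omega, hp i hi⟩
  refine min_le_min le_rfl (add_le_add ?_ ?_)
  · refine (Finset.card_le_card (t := Finset.image p _) ?_).trans Finset.card_image_le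
    intro z hz
    obtain ⟨h1, h2⟩ := hA z hz
    obtain ⟨i, hi, rfl⟩ := key z h1
    rw [Finset.mem_image]
    refine ⟨i, ?_, rfl⟩
    simp only [Finset.mem_filter, Finset.mem_Icc]
    rw [← hp0] at h2
    refine ⟨⟨?_, hi⟩, h2⟩
    rcases Nat.eq_zero_or_pos i with rfl | h
    · exact absurd h2 (G.irrefl)
    · exact h
  · refine (Finset.card_le_card (t := Finset.image p _) ?_).trans Finset.card_image_le
    intro z hz
    obtain ⟨h1, h2⟩ := hB z hz
    obtain ⟨i, hi, rfl⟩ := key z h1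
    rw [Finset.mem_image]
    refine ⟨i, ?_, rfl⟩
    simp only [Finset.mem_filter, Finset.mem_range]
    rw [← hpm] at h2
    refine ⟨?_, h2⟩
    rcases Nat.eq_or_lt_of_le hi with rfl | h
    · exact absurd h2 (G.irrefl)
    · exact h


theorem chain_walk {V : Type*} {G : SimpleGraph V} : ∀ (l : List V) (a s : V),
    (a :: l).IsChain G.Adj → (a :: l).getLast? = some s → ∃ w : G.Walk a s, w.support = a :: l := by
  intro l
  induction l with
  | nil => intro a s _ h; simp at h; subst h; exact ⟨Walk.nil, rfl⟩
  | cons b l ih =>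
    intro a s hc hl
    rw [List.isChain_cons_cons] at hc
    obtain ⟨w, hw⟩ := ih b s hc.2 (by simpa using hl)
    exact ⟨Walk.cons hc.1 w, by simp [hw]⟩

theorem lcyc_walk {V : Type*} {G : SimpleGraph V} {l : List V} (h : LCyc G l) (h3 : 3 ≤ l.length) :
    ∃ (v : V) (w : G.Walk v v), w.IsCycle ∧ w.length = l.length := by
  obtain ⟨s, hc, hl, hn⟩ := h
  cases l with
  | nil => simp at h3
  | cons a l =>
    rw [List.isChain_cons_cons] at hc
    obtain ⟨w, hw⟩ := chain_walk l a s hc.2 hl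
    have hlen : w.length = l.length := by
      have := w.length_support
      rw [hw] at this; simpa using this.symm
    refine ⟨s, Walk.cons hc.1 w, ?_, by simp [hlen]⟩
    rw [Walk.cons_isCycle_iff]
    have hp : w.IsPath := by rw [Walk.isPath_def, hw]; exact hn
    refine ⟨hp, ?_⟩
    intro hmem
    cases w with
    | nil => exact G.irrefl hc.1
    | cons h' w' =>
      rename_i b
      rw [Walk.cons_isPath_iff] at hp
      simp only [Walk.edges_cons, List.mem_cons] at hmem
      rcases hmem with hmem | hmem
      · rw [Sym2.eq_iff] at hmem
        rcases hmem with ⟨h1, _⟩ | ⟨h1, _⟩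
        · exact hc.1.ne h1
        · subst h1
          have := Walk.length_eq_zero_iff.2 (Walk.isPath_iff_nil.1 hp.1)
          simp at hlen h3
          omega
      · exact hp.2 (Walk.snd_mem_support_of_mem_edges _ hmem)

/-- No cycle is longer than `c`. -/
def NoLong {V : Type*} (G : SimpleGraph V) (c : ℕ) : Prop :=
  ∀ l, LCyc G l → 3 ≤ l.length → l.length ≤ c

theorem cycle_bdd {V : Type*} [Finite V] (G : SimpleGraph V) :
    BddAbove {n | ∃ (v : V) (w : G.Walk v v), w.IsCycle ∧ w.length = n} := by
  classical
  have := Fintype.ofFinite V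
  refine ⟨Fintype.card V, ?_⟩
  rintro _ ⟨v, w, hw, rfl⟩
  have := hw.support_nodup.length_le_card
  simpa using this

theorem noLong_of_circ {V : Type*} [Finite V] (G : SimpleGraph V) (c : ℕ) (h : circ G = c) :
    NoLong G c := by
  intro l hl h3
  obtain ⟨v, w, hw, hlen⟩ := lcyc_walk hl h3
  rw [← h, ← hlen]
  exact le_csSup (cycle_bdd G) ⟨v, w, hw, rfl⟩

/-- `P` is the vertex list of a path from `x` to `y`. -/
def Pth {V : Type*} (G : SimpleGraph V) (x y : V) (P : List V) : Prop :=
  P.IsChain G.Adj ∧ P.Nodup ∧ P.head? = some x ∧ P.getLast? = some y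

theorem Pth.reverse {V : Type*} {G : SimpleGraph V} {x y : V} {P : List V} (h : Pth G x y P) :
    Pth G y x P.reverse := by
  obtain ⟨h1, h2, h3, h4⟩ := h
  exact ⟨chain_rev h1, List.nodup_reverse.2 h2, by rw [List.head?_reverse, h4],
    by rw [List.getLast?_reverse, h3]⟩

theorem pth_drop_edge {V : Type*} {G : SimpleGraph V} {x y a b : V} {Q : List V}
    (hab : (a = x ∧ b = y) ∨ (a = y ∧ b = x)) (hQ : Pth (G ⊔ edge x y) b a Q) (h3 : 3 ≤ Q.length) :
    Pth G b a Q := by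
  obtain ⟨h1, h2, h3', h4⟩ := hQ
  refine ⟨?_, h2, h3', h4⟩
  rw [List.isChain_iff_getElem] at h1 ⊢
  intro i hi
  have h := h1 i hi
  rw [sup_adj, edge_adj] at h
  rcases h with h | ⟨h, -⟩
  · exact h
  · exfalso
    have e0 : Q[0] = b := by
      rw [List.head?_eq_getElem?, List.getElem?_eq_getElem (by omega)] at h3'
      exact Option.some.inj h3'
    have e1 : Q[Q.length - 1] = a := by
      rw [List.getLast?_eq_getElem?, List.getElem?_eq_getElem (by omega)] at h4
      exact Option.some.inj h4
    have h' : (Q[i] = a ∧ Q[i + 1] = b) ∨ (Q[i] = b ∧ Q[i + 1] = a) := by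
      rcases hab with ⟨rfl, rfl⟩ | ⟨rfl, rfl⟩ <;> tauto
    rcases h' with ⟨_, h⟩ | ⟨_, h⟩
    · rw [← e0, List.Nodup.getElem_inj_iff h2] at h; omega
    · rw [← e1, List.Nodup.getElem_inj_iff h2] at h
      have h'' : Q[i] = b := by assumption
      rw [← e0, List.Nodup.getElem_inj_iff h2] at h''; omega

theorem long_path {V : Type*} {G : SimpleGraph V} {c : ℕ}
    (hmax : Maximal (fun G => NoLong G c) G) {x y : V} (hxy : x ≠ y) (hadj : ¬ G.Adj x y) :
    ∃ P, Pth G x y P ∧ c + 1 ≤ P.length := by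
  have hnot : ¬ NoLong (G ⊔ edge x y) c := by
    intro h
    have := hmax.2 h le_sup_left
    refine hadj (this ?_)
    rw [sup_adj, edge_adj]; simp [hxy]
  unfold NoLong at hnot
  push Not at hnot
  obtain ⟨l, ⟨s, hc, hl, hn⟩, h3, hlen⟩ := hnot
  suffices hQ : ∃ a b Q, ((a = x ∧ b = y) ∨ (a = y ∧ b = x)) ∧ Pth (G ⊔ edge x y) b a Q ∧
      Q.length = l.length by
    obtain ⟨a, b, Q, hab, hQ, hQl⟩ := hQ
    have hQ' := pth_drop_edge hab hQ (by omega)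
    rcases hab with ⟨rfl, rfl⟩ | ⟨rfl, rfl⟩
    · exact ⟨Q.reverse, hQ'.reverse, by simp; omega⟩
    · exact ⟨Q, hQ', by omega⟩
  have hnc : ¬ (s :: l).IsChain G.Adj := by
    intro h
    have := hmax.1 l ⟨s, h, hl, hn⟩ h3
    omega
  rw [List.isChain_iff_forall_rel_of_append_cons_cons] at hnc
  push Not at hnc
  obtain ⟨a, b, l1, l2, he, hnab⟩ := hnc
  have hab : (G ⊔ edge x y).Adj a b := by
    rw [List.isChain_iff_forall_rel_of_append_cons_cons] at hc
    exact hc he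
  have hab' : (a = x ∧ b = y) ∨ (a = y ∧ b = x) := by
    rw [sup_adj, edge_adj] at hab
    tauto
  cases l1 with
  | nil =>
    simp at he
    obtain ⟨rfl, rfl⟩ := he
    exact ⟨s, b, b :: l2, hab', ⟨by simpa using hc.tail, hn, rfl, hl⟩, rfl⟩
  | cons s' l1 =>
    simp at he
    obtain ⟨rfl, rfl⟩ := he
    refine ⟨a, b, (b :: l2) ++ (l1 ++ [a]), hab', ⟨?_, ?_, rfl, ?_⟩, by simp; omega⟩
    · rw [← List.cons_append, List.isChain_append_cons_cons] at hc
      obtain ⟨hc1, _, hc2⟩ := hc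
      rw [List.cons_append, List.isChain_cons] at hc1
      rw [List.isChain_append]
      refine ⟨hc2, hc1.2, ?_⟩
      have hl' : (b :: l2).getLast? = some s := by
        rw [← hl]
        have : l1 ++ a :: b :: l2 = (l1 ++ [a]) ++ b :: l2 := by simp
        rw [this, List.getLast?_append_cons]
      rw [hl']
      simpa using hc1.1
    · have : ((b :: l2) ++ (l1 ++ [a])).Perm (l1 ++ a :: b :: l2) := by
        have h : l1 ++ a :: b :: l2 = (l1 ++ [a]) ++ b :: l2 := by simp
        rw [h]; exact List.perm_append_comm
      exact this.nodup_iff.2 hn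
    · rw [← List.append_assoc, List.getLast?_concat]

open Classical in
theorem lemM {V : Type*} [Fintype V] {G : SimpleGraph V} {c : ℕ} (hc : 2 ≤ c) (hG : TwoConnected G)
    (hmax : Maximal (fun G => NoLong G c) G) (A B : Finset V) (dA dB : ℕ)
    (hA : ∀ x ∈ A, dA ≤ (A.filter (G.Adj x)).card) (hB : ∀ x ∈ B, dB ≤ (B.filter (G.Adj x)).card)
    (hd : c + 1 ≤ dA + dB) (x : V) (hx : x ∈ A) (y : V) (hy : y ∈ B) (hxy : x ≠ y) : G.Adj x y := by
  by_contra hadj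
  let Q : ℕ → Prop := fun len => ∃ x ∈ A, ∃ y ∈ B, x ≠ y ∧ ¬ G.Adj x y ∧ ∃ P, Pth G x y P ∧ P.length = len
  have hbd : ∀ len, Q len → len ≤ Fintype.card V := by
    rintro _ ⟨x, _, y, _, _, _, P, hP, rfl⟩
    exact hP.2.1.length_le_card
  obtain ⟨P0, hP0, hP0l⟩ := long_path hmax hxy hadj
  have hQ0 : Q P0.length := ⟨x, hx, y, hy, hxy, hadj, P0, hP0, rfl⟩
  have hspec := Nat.findGreatest_spec (hbd _ hQ0) hQ0
  have hge := Nat.le_findGreatest (hbd _ hQ0) hQ0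
  have hgr : ∀ k, Nat.findGreatest Q (Fintype.card V) < k → ¬ Q k := fun k hk hQ =>
    Nat.findGreatest_is_greatest hk (hbd _ hQ) hQ
  generalize Nat.findGreatest Q (Fintype.card V) = L at *
  clear hQ0
  clear! x y
  obtain ⟨x, hx, y, hy, hxy, hadj, P, hP, rfl⟩ := hspec
  have hmemx : x ∈ P := List.mem_of_head? hP.2.2.1
  have hmemy : y ∈ P := List.mem_of_getLast? hP.2.2.2
  have hxP : ∀ z ∈ A.filter (G.Adj x), z ∈ P ∧ G.Adj x z := by
    intro z hz
    rw [Finset.mem_filter] at hz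
    refine ⟨?_, hz.2⟩
    by_contra hzP
    have hPz : Pth G z y (z :: P) := by
      refine ⟨?_, List.nodup_cons.2 ⟨hzP, hP.2.1⟩, rfl, ?_⟩
      · rw [List.isChain_cons, hP.2.2.1]
        exact ⟨by simpa using hz.2.symm, hP.1⟩
      · rw [List.getLast?_cons, hP.2.2.2]; rfl
    by_cases hzy : G.Adj z y
    · have := hmax.1 (z :: P) ⟨y, List.isChain_cons_cons.2 ⟨hzy.symm, hPz.1⟩, hPz.2.2.2, hPz.2.1⟩
        (by simp; omega)
      simp at this; omega
    · exact hgr (P.length + 1) (by omega) ⟨z, hz.1, y, hy, by rintro rfl; exact hzP hmemy, hzy,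
        z :: P, hPz, by simp⟩
  have hyP : ∀ z ∈ B.filter (G.Adj y), z ∈ P ∧ G.Adj y z := by
    intro z hz
    rw [Finset.mem_filter] at hz
    refine ⟨?_, hz.2⟩
    by_contra hzP
    have hPz : Pth G x z (P ++ [z]) := by
      refine ⟨?_, ?_, ?_, ?_⟩
      · rw [List.isChain_append, hP.2.2.2]
        exact ⟨hP.1, by simp, by simpa using hz.2⟩
      · have := List.nodup_cons.2 ⟨hzP, hP.2.1⟩
        grind
      · rw [List.head?_append, hP.2.2.1]; rfl
      · rw [List.getLast?_concat]
    by_cases hzx : G.Adj z x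
    · have := hmax.1 (P ++ [z]) ⟨z, ?_, hPz.2.2.2, hPz.2.1⟩ (by simp; omega)
      · simp at this; omega
      · rw [List.isChain_cons, hPz.2.2.1]
        exact ⟨by simpa using hzx, hPz.1⟩
    · exact hgr (P.length + 1) (by omega) ⟨x, hx, z, hz.1, by rintro rfl; exact hzP hmemx,
        fun h => hzx h.symm, P ++ [z], hPz, by simp⟩
  obtain ⟨l, hl, hlen⟩ := kop_list hG P x y (by omega) hP.1 hP.2.1 hP.2.2.1 hP.2.2.2 _ _ hxP hyP
  have h1 := hA x hx
  have h2 := hB y hy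
  have h3 : c + 1 ≤ l.length := le_trans (le_min (by omega) (by omega)) hlen
  have := hmax.1 l hl (by omega)
  omega

theorem clique_le {V : Type*} {G : SimpleGraph V} {c : ℕ} (hN : NoLong G c) (H : Finset V)
    (hH : ∀ x ∈ H, ∀ y ∈ H, x ≠ y → G.Adj x y) (h3 : 3 ≤ H.card) : H.card ≤ c := by
  have hlen : H.toList.length = H.card := Finset.length_toList H
  rw [← hlen]
  refine hN _ ?_ (by omega)
  have hn := H.nodup_toList
  have hm : ∀ x, x ∈ H.toList ↔ x ∈ H := fun x => Finset.mem_toList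
  generalize H.toList = l at *
  have hl : l ≠ [] := by rintro rfl; simp at hlen; omega
  refine ⟨l.getLast hl, ?_, List.getLast?_eq_some_getLast hl, hn⟩
  rw [List.isChain_cons]
  constructor
  · rw [List.head?_eq_some_head hl]
    simp only [Option.mem_def, Option.some.injEq, forall_eq']
    refine hH _ ((hm _).1 (List.getLast_mem hl)) _ ((hm _).1 (List.head_mem hl)) ?_
    rw [List.getLast_eq_getElem, List.head_eq_getElem, Ne, List.Nodup.getElem_inj_iff hn]
    omega
  · rw [List.isChain_iff_getElem]
    intro i hi
    refine hH _ ((hm _).1 (List.getElem_mem _)) _ ((hm _).1 (List.getElem_mem _)) ?_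
    rw [Ne, List.Nodup.getElem_inj_iff hn]
    omega

open Classical in
/-- Twice the number of edges inside `S`. -/
noncomputable def e2 {V : Type*} (G : SimpleGraph V) (S : Finset V) : ℕ :=
  ∑ v ∈ S, (S.filter (G.Adj v)).card

open Classical in
theorem e2_erase {V : Type*} (G : SimpleGraph V) (S : Finset V) (v : V) (hv : v ∈ S) :
    e2 G S = e2 G (S.erase v) + 2 * (S.filter (G.Adj v)).card := by
  obtain ⟨S', hS', rfl⟩ : ∃ S', v ∉ S' ∧ S = insert v S' :=
    ⟨S.erase v, by simp, by simp [Finset.insert_erase hv]⟩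
  rw [Finset.erase_insert hS']
  unfold e2
  rw [Finset.sum_insert hS']
  have h1 : ∀ u ∈ S', ((insert v S').filter (G.Adj u)).card
      = (S'.filter (G.Adj u)).card + if G.Adj v u then 1 else 0 := by
    intro u _
    rw [Finset.filter_insert]
    by_cases h : G.Adj u v
    · rw [if_pos h, if_pos h.symm, Finset.card_insert_of_notMem (by simp [hS'])]
    · rw [if_neg h, if_neg (fun h' => h h'.symm)]; rfl
  rw [Finset.sum_congr rfl h1, Finset.sum_add_distrib, Finset.filter_insert, if_neg G.irrefl,
    ← Finset.card_filter]
  ring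

open Classical in
theorem lemE {V : Type*} (G : SimpleGraph V) (H : Finset V) (N0 s : ℕ)
    (h : ∀ S, H ⊆ S → N0 < S.card → ∃ v ∈ S, v ∉ H ∧ (S.filter (G.Adj v)).card ≤ s) :
    ∀ (d : ℕ) (S : Finset V), H ⊆ S → S.card = N0 + d → e2 G S ≤ N0 * (N0 - 1) + 2 * (d * s) := by
  intro d
  induction d with
  | zero =>
    intro S _ hS
    simp at hS
    have : e2 G S ≤ S.card * (S.card - 1) := by
      unfold e2
      rw [← smul_eq_mul]
      refine Finset.sum_le_card_nsmul _ _ _ ?_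
      intro v hv
      rw [← Finset.card_erase_of_mem hv]
      refine Finset.card_le_card ?_
      intro u hu
      simp only [Finset.mem_filter, Finset.mem_erase] at hu ⊢
      exact ⟨hu.2.ne', hu.1⟩
    rw [hS] at this; simpa using this
  | succ d ih =>
    intro S hHS hS
    obtain ⟨v, hv, hvH, hvd⟩ := h S hHS (by omega)
    have := ih (S.erase v) (fun u hu => Finset.mem_erase.2 ⟨by rintro rfl; exact hvH hu, hHS hu⟩)
      (by rw [Finset.card_erase_of_mem hv]; omega)
    rw [e2_erase G S v hv]
    nlinarith

theorem e2_univ {V : Type*} [Fintype V] (G : SimpleGraph V) :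
    e2 G Finset.univ = 2 * edgeCount G := by
  classical
  unfold e2 edgeCount
  rw [Nat.card_eq_fintype_card, ← edgeFinset_card, ← sum_degrees_eq_twice_card_edges]
  refine Finset.sum_congr rfl fun v _ => ?_
  rw [← card_neighborFinset_eq_degree, neighborFinset_eq_filter]

theorem two_f (n c j : ℕ) : 2 * fCliques n c j 2 = (c + 1 - j) * (c + 1 - j - 1) + 2 * ((n + j - c - 1) * j) := by
  unfold fCliques
  rw [mul_add, Nat.choose_two_right, Nat.mul_div_cancel' (Nat.even_mul_pred_self _).two_dvd]
  simp

theorem f_convex (n c k s t : ℕ) (hn : c + 1 ≤ n) (hks : k ≤ s) (hst : s ≤ t) (htc : t ≤ c) :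
    fCliques n c s 2 ≤ max (fCliques n c k 2) (fCliques n c t 2) := by
  have h1 := two_f n c s
  have h2 := two_f n c k
  have h3 := two_f n c t
  obtain ⟨a, rfl⟩ := Nat.exists_eq_add_of_le hn
  obtain ⟨b, rfl⟩ := Nat.exists_eq_add_of_le hks
  obtain ⟨d, rfl⟩ := Nat.exists_eq_add_of_le hst
  obtain ⟨e, rfl⟩ := Nat.exists_eq_add_of_le htc
  rw [show k + b + d + e + 1 - (k + b) = d + e + 1 by omega,
    show k + b + d + e + 1 + a + (k + b) - (k + b + d + e) - 1 = a + k + b by omega] at h1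
  rw [show k + b + d + e + 1 - k = b + d + e + 1 by omega,
    show k + b + d + e + 1 + a + k - (k + b + d + e) - 1 = a + k by omega] at h2
  rw [show k + b + d + e + 1 - (k + b + d) = e + 1 by omega,
    show k + b + d + e + 1 + a + (k + b + d) - (k + b + d + e) - 1 = a + k + b + d by omega] at h3
  simp only [Nat.add_sub_cancel] at h1 h2 h3
  by_cases hc : 3 * (k + b + k) + 2 * a ≤ 2 * (k + b + d + e) + 1
  · refine le_trans ?_ (le_max_left _ _)
    nlinarith [Nat.mul_le_mul_left b hc]
  · refine le_trans ?_ (le_max_right _ _)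
    push Not at hc
    nlinarith [Nat.mul_le_mul_left d hc.le, Nat.zero_le (d * (b+d)), Nat.zero_le (d*b)]

open Classical in
theorem upper {V : Type} [Fintype V] (G : SimpleGraph V) (n c k : ℕ) (h1 : c ≤ n - 1)
    (h2 : 2 * k ≤ c) (h3 : 2 ≤ k) (hV : Fintype.card V = n) (hG : TwoConnected G)
    (hmax : Maximal (fun G => NoLong G c) G)
    (hdeg : ∀ v, k ≤ (Finset.univ.filter (G.Adj v)).card) :
    edgeCount G ≤ max (fCliques n c k 2) (fCliques n c (c / 2) 2) := by
  obtain ⟨t, ht⟩ : ∃ t, t = c / 2 := ⟨_, rfl⟩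
  rw [← ht]
  have hcard : (Finset.univ : Finset V).card = n := hV
  by_cases hA : ∃ S : Finset V, S.Nonempty ∧ ∀ x ∈ S, t + 1 ≤ (S.filter (G.Adj x)).card
  · obtain ⟨S, hS⟩ := hA
    obtain ⟨H, -, hH⟩ := Finite.exists_le_maximal (p := fun S : Finset V =>
      S.Nonempty ∧ ∀ x ∈ S, t + 1 ≤ (S.filter (G.Adj x)).card) hS
    obtain ⟨⟨hHne, hHd⟩, hHmax⟩ := hH
    have hcl : ∀ x ∈ H, ∀ y ∈ H, x ≠ y → G.Adj x y := fun x hx y hy =>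
      lemM (by omega) hG hmax H H (t + 1) (t + 1) hHd hHd (by omega) x hx y hy
    have hfe : ∀ x ∈ H, H.filter (G.Adj x) = H.erase x := by
      intro x hx
      ext u
      simp only [Finset.mem_filter, Finset.mem_erase]
      exact ⟨fun h => ⟨h.2.ne', h.1⟩, fun h => ⟨h.2, hcl x hx u h.2 h.1.symm⟩⟩
    have hr : t + 2 ≤ H.card := by
      obtain ⟨x, hx⟩ := hHne
      have := hHd x hx
      rw [hfe x hx, Finset.card_erase_of_mem hx] at this
      omega
    have hrc : H.card ≤ c := clique_le hmax.1 H hcl (by omega)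
    obtain ⟨s, hs⟩ : ∃ s, s = c + 1 - H.card := ⟨_, rfl⟩
    have hno : ∀ S : Finset V, H ⊆ S → H.card < S.card →
        ∃ v ∈ S, v ∉ H ∧ (S.filter (G.Adj v)).card ≤ s := by
      intro S hHS hlt
      by_contra hcon
      push Not at hcon
      have hSd : ∀ x ∈ S, s + 1 ≤ (S.filter (G.Adj x)).card := by
        intro x hx
        by_cases hxH : x ∈ H
        · have h1 := hHd x hxH
          have h2 : (H.filter (G.Adj x)).card ≤ (S.filter (G.Adj x)).card :=
            Finset.card_le_card (Finset.filter_subset_filter _ hHS)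
          omega
        · exact hcon x hx hxH
      obtain ⟨y, hyS, hyH⟩ := Finset.exists_mem_notMem_of_card_lt_card hlt
      have hyadj : ∀ x ∈ H, G.Adj x y := fun x hx =>
        lemM (by omega) hG hmax H S (H.card - 1) (s + 1)
          (fun x hx => by rw [hfe x hx, Finset.card_erase_of_mem hx]) hSd (by omega) x hx y hyS
          (by rintro rfl; exact hyH hx)
      have hins : insert y H ⊆ H := by
        refine hHmax (y := insert y H) ⟨Finset.insert_nonempty _ _, ?_⟩ (Finset.subset_insert _ _)
        intro x hx
        rw [Finset.mem_insert] at hx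
        rcases hx with rfl | hx
        · have : H ⊆ (insert x H).filter (G.Adj x) := by
            intro u hu
            simp only [Finset.mem_filter, Finset.mem_insert]
            exact ⟨Or.inr hu, (hyadj u hu).symm⟩
          have := Finset.card_le_card this
          omega
        · exact (hHd x hx).trans
            (Finset.card_le_card (Finset.filter_subset_filter _ (Finset.subset_insert _ _)))
      exact hyH (hins (Finset.mem_insert_self _ _))
    have hks : k ≤ s := by
      obtain ⟨v, _, _, hv⟩ := hno Finset.univ (Finset.subset_univ _) (by omega)
      exact (hdeg v).trans hv
    have hE := lemE G H H.card s hno (n - H.card) Finset.univ (Finset.subset_univ _) (by omega)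
    rw [e2_univ] at hE
    have hf := two_f n c s
    rw [show c + 1 - s = H.card by omega, show n + s - c - 1 = n - H.card by omega] at hf
    have hle : edgeCount G ≤ fCliques n c s 2 := by omega
    exact hle.trans (f_convex n c k s t (by omega) hks (by omega) (by omega))
  · push Not at hA
    have hE := lemE G ∅ (c + 1 - t) t (by
      intro S _ hS
      obtain ⟨v, hv, hvd⟩ := hA S (Finset.card_pos.1 (by omega))
      exact ⟨v, hv, by simp, by omega⟩) (n + t - c - 1) Finset.univ (Finset.subset_univ _) (by omega)
    rw [e2_univ] at hE
    have hf := two_f n c t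
    refine le_trans ?_ (le_max_right _ _)
    omega

theorem upper_main (n c k : ℕ) (h1 : c ≤ n - 1) (h2 : 2 * k ≤ c) (h3 : 2 ≤ k)
    (V : Type) (G : SimpleGraph V) (hV : Nat.card V = n) (hG : TwoConnected G) (hcirc : circ G = c)
    (hdeg : ∀ v, k ≤ degN G v) :
    edgeCount G ≤ max (fCliques n c k 2) (fCliques n c (c / 2) 2) := by
  classical
  have hfin : Finite V := Nat.finite_of_card_ne_zero (by omega)
  have := Fintype.ofFinite V
  obtain ⟨G', hle, hmax⟩ := Finite.exists_le_maximal (p := fun G : SimpleGraph V => NoLong G c)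
    (noLong_of_circ G c hcirc)
  have hG' : TwoConnected G' := by
    refine ⟨hG.1, fun v => ?_⟩
    refine (hG.2 v).mono ?_
    intro x y h
    exact hle h
  have hec : edgeCount G ≤ edgeCount G' :=
    Nat.card_mono (Set.toFinite _) (edgeSet_mono hle)
  refine hec.trans (upper G' n c k h1 h2 h3 (by rw [← hV, Nat.card_eq_fintype_card]) hG' hmax ?_)
  intro v
  refine (hdeg v).trans ?_
  unfold degN
  rw [Nat.card_eq_fintype_card, card_neighborSet_eq_degree, ← card_neighborFinset_eq_degree]
  refine Finset.card_le_card ?_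
  intro u hu
  rw [mem_neighborFinset] at hu
  simp only [Finset.mem_filter, Finset.mem_univ, true_and]
  exact hle hu


theorem fin_card_lt (n N : ℕ) (h : N ≤ n) :
    ((Finset.univ : Finset (Fin n)).filter (fun u => u.val < N)).card = N := by
  rw [Fin.card_filter_val_lt]; omega

theorem fg_edges (n c j : ℕ) (hj : 2 * j ≤ c) (hn : c + 1 ≤ n) :
    edgeCount (Fgraph n c j) = fCliques n c j 2 := by
  classical
  let S : ℕ → Finset (Fin n) := fun N => Finset.univ.filter (fun u => u.val < N)
  have hstep : ∀ N (hN : N < n), e2 (Fgraph n c j) (S (N + 1)) =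
      e2 (Fgraph n c j) (S N) + 2 * (if N ≤ c - j then N else j) := by
    intro N hN
    have hmem : (⟨N, hN⟩ : Fin n) ∈ S (N + 1) := by simp [S]
    have he := e2_erase (Fgraph n c j) _ _ hmem
    have h1 : (S (N + 1)).erase ⟨N, hN⟩ = S N := by
      ext u
      simp only [S, Finset.mem_erase, Finset.mem_filter, Finset.mem_univ, true_and, Ne, Fin.ext_iff]
      omega
    have h1' : e2 (Fgraph n c j) ((S (N + 1)).erase ⟨N, hN⟩) = e2 (Fgraph n c j) (S N) := by
      rw [h1]
    refine Eq.trans (b := e2 (Fgraph n c j) ((S (N + 1)).erase ⟨N, hN⟩) +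
      2 * ((S (N + 1)).filter ((Fgraph n c j).Adj ⟨N, hN⟩)).card) ?_ ?_
    · convert he
    rw [h1']
    congr 2
    split_ifs with h
    · refine Eq.trans ?_ (fin_card_lt n N hN.le)
      congr 1
      ext u
      simp only [S, Finset.mem_filter, Finset.mem_univ, true_and, Fgraph, Ne, Fin.ext_iff]
      omega
    · refine Eq.trans ?_ (fin_card_lt n j (by omega))
      congr 1
      ext u
      simp only [S, Finset.mem_filter, Finset.mem_univ, true_and, Fgraph, Ne, Fin.ext_iff]
      omega
  have ha : ∀ N, N ≤ c - j + 1 → e2 (Fgraph n c j) (S N) = N * (N - 1) := by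
    intro N
    induction N with
    | zero => intro _; simp [S, e2]
    | succ N ih =>
      intro h
      rw [hstep N (by omega), ih (by omega), if_pos (by omega)]
      cases N with
      | zero => rfl
      | succ N => simp; ring
  have hb : ∀ d, c - j + 1 + d ≤ n → e2 (Fgraph n c j) (S (c - j + 1 + d)) =
      (c - j + 1) * (c - j) + 2 * (d * j) := by
    intro d
    induction d with
    | zero => intro _; simp [ha]
    | succ d ih =>
      intro h
      rw [← add_assoc, hstep _ (by omega), ih (by omega), if_neg (by omega)]
      ring
  have hfin := hb (n + j - c - 1) (by omega)
  have hu : S (c - j + 1 + (n + j - c - 1)) = Finset.univ := by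
    ext u
    have := u.isLt
    simp only [S, Finset.mem_filter, Finset.mem_univ, true_and, iff_true]
    omega
  rw [hu, e2_univ] at hfin
  have hf := two_f n c j
  rw [show c + 1 - j = c - j + 1 by omega, Nat.add_sub_cancel] at hf
  omega

theorem fg_conn (n c j : ℕ) (hj2 : 2 ≤ j) (hj : 2 * j ≤ c) (hn : c + 1 ≤ n) :
    TwoConnected (Fgraph n c j) := by
  refine ⟨by simp; omega, ?_⟩
  intro v
  obtain ⟨a, haj, hav⟩ : ∃ a : Fin n, a.val < j ∧ a ≠ v := by
    by_cases h : v.val = 0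
    · exact ⟨⟨1, by omega⟩, by simp; omega, by rw [Ne, Fin.ext_iff]; simp; omega⟩
    · exact ⟨⟨0, by omega⟩, by simp; omega, by rw [Ne, Fin.ext_iff]; simp; omega⟩
  have hr : ∀ x : {u : Fin n | u ≠ v}, ((Fgraph n c j).induce {u | u ≠ v}).Reachable ⟨a, hav⟩ x := by
    rintro ⟨x, hx⟩
    by_cases hxa : a = x
    · subst hxa; exact Reachable.refl _
    · refine Adj.reachable ?_
      rw [induce_adj]
      exact ⟨hxa, Or.inl haj⟩
  have : Nonempty {u : Fin n | u ≠ v} := ⟨⟨a, hav⟩⟩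
  exact ⟨fun x y => (hr x).symm.trans (hr y)⟩

theorem fg_deg (n c j : ℕ) (hj : 2 * j ≤ c) (hn : c + 1 ≤ n) (v : Fin n) :
    j ≤ degN (Fgraph n c j) v := by
  classical
  unfold degN
  rw [Nat.card_eq_fintype_card, card_neighborSet_eq_degree, ← card_neighborFinset_eq_degree]
  by_cases hv : v.val < j
  · have h1 : ((Finset.univ : Finset (Fin n)).filter (fun u => u.val < j + 1)).erase v ⊆
        (Fgraph n c j).neighborFinset v := by
      intro u hu
      rw [mem_neighborFinset]
      simp only [Finset.mem_erase] at hu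
      exact ⟨hu.1.symm, Or.inl hv⟩
    have := Finset.card_le_card h1
    rw [Finset.card_erase_of_mem (by simp; omega), fin_card_lt n (j + 1) (by omega)] at this
    omega
  · have h1 : ((Finset.univ : Finset (Fin n)).filter (fun u => u.val < j)) ⊆
        (Fgraph n c j).neighborFinset v := by
      intro u hu
      rw [mem_neighborFinset]
      simp only [Finset.mem_filter, Finset.mem_univ, true_and] at hu
      refine ⟨?_, Or.inr (Or.inl hu)⟩
      rintro rfl; exact hv hu
    have := Finset.card_le_card h1
    rwa [fin_card_lt n j (by omega)] at this

theorem fg_has_cycle (n c j : ℕ) (hj2 : 2 ≤ j) (hj : 2 * j ≤ c) (hn : c + 1 ≤ n) :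
    ∃ (v : Fin n) (w : (Fgraph n c j).Walk v v), w.IsCycle ∧ w.length = c := by
  let f : ℕ → ℕ := fun i =>
    if i < 2 * j - 1 then (if i % 2 = 0 then i / 2 else c - j + 1 + i / 2) else i - j + 1
  let q : ℕ → Fin n := fun i => if h : f i < n then ⟨f i, h⟩ else ⟨0, by omega⟩
  have hq : ∀ i, i < c → (q i).val = f i := by
    intro i hi
    have : f i < n := by
      simp only [f]; split_ifs <;> omega
    simp [q, this]
  have hinj : Set.InjOn q (Set.Iic (c - 1)) := by
    intro x hx y hy hxy
    simp only [Set.mem_Iic] at hx hy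
    have h := congrArg Fin.val hxy
    rw [hq x (by omega), hq y (by omega)] at h
    simp only [f] at h
    split_ifs at h <;> omega
  have hadj : ∀ i < c - 1, (Fgraph n c j).Adj (q i) (q (i + 1)) := by
    intro i hi
    refine ⟨fun h => ?_, ?_⟩
    · have := hinj (by simp; omega) (by simp; omega) h
      omega
    · rw [hq i (by omega), hq (i + 1) (by omega)]
      simp only [f]
      split_ifs <;> omega
  have hclose : (Fgraph n c j).Adj (q (c - 1)) (q 0) := by
    refine ⟨fun h => ?_, ?_⟩
    · have := hinj (by simp) (by simp) h
      omega
    · rw [hq (c - 1) (by omega), hq 0 (by omega)]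
      simp only [f]
      split_ifs <;> omega
  have hl : LCyc (Fgraph n c j) (seg q 0 (c - 1)) := by
    refine ⟨q (c - 1), ?_, seg_last q (by omega), seg_nodup hinj _ _ le_rfl⟩
    rw [List.isChain_cons, seg_head q (by omega)]
    exact ⟨by simpa using hclose, seg_chain hadj _ _ le_rfl⟩
  have hlen : (seg q 0 (c - 1)).length = c := by rw [seg_length]; omega
  obtain ⟨v, w, hw, hwl⟩ := lcyc_walk hl (by omega)
  exact ⟨v, w, hw, by omega⟩

theorem fg_cycle_le (n c j : ℕ) (hj2 : 2 ≤ j) (hj : 2 * j ≤ c)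
    (v : Fin n) (w : (Fgraph n c j).Walk v v) (hw : w.IsCycle) : w.length ≤ c := by
  classical
  by_contra hcon
  push Not at hcon
  obtain ⟨L, hL⟩ : ∃ L, L = w.length := ⟨_, rfl⟩
  rw [← hL] at hcon
  let g : ℕ → ℕ := fun i => (w.getVert i).val
  have hadj : ∀ i < L, g i < j ∨ g (i + 1) < j ∨ (g i ≤ c - j ∧ g (i + 1) ≤ c - j) := fun i hi =>
    (w.adj_getVert_succ (by omega)).2
  have inj1 : ∀ x y, 1 ≤ x → x ≤ L → 1 ≤ y → y ≤ L → g x = g y → x = y := fun x y h1 h2 h3 h4 h =>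
    hw.getVert_injOn ⟨h1, by omega⟩ ⟨h3, by omega⟩ (Fin.ext h)
  have inj0 : ∀ x y, x < L → y < L → g x = g y → x = y := fun x y h1 h2 h =>
    hw.getVert_injOn' (by simp; omega) (by simp; omega) (Fin.ext h)
  have hclose : g L = g 0 := by simp [g, hL]
  clear_value g
  let I := (Finset.range L).filter (fun i => c - j < g i)
  let J := (Finset.range L).filter (fun i => ¬ c - j < g i)
  have hIJ : I.card + J.card = L := by
    have := Finset.card_filter_add_card_filter_not (s := Finset.range L) (fun i => c - j < g i)
    rw [Finset.card_range] at this
    convert this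
  have hIim : I.image (fun i => g (i + 1)) ⊆ Finset.range j := by
    intro a ha
    obtain ⟨i, hi, rfl⟩ := Finset.mem_image.1 ha
    simp only [I, Finset.mem_filter, Finset.mem_range] at hi ⊢
    have := hadj i hi.1
    omega
  have hIc : (I.image (fun i => g (i + 1))).card = I.card := by
    refine Finset.card_image_of_injOn ?_
    intro x hx y hy hxy
    simp only [I, Finset.coe_filter, Finset.mem_range, Set.mem_ofPred_eq] at hx hy
    have := inj1 (x + 1) (y + 1) (by omega) (by omega) (by omega) (by omega) hxy
    omega
  have hJim : J.image g ⊆ Finset.range (c - j + 1) := by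
    intro a ha
    obtain ⟨i, hi, rfl⟩ := Finset.mem_image.1 ha
    simp only [J, Finset.mem_filter, Finset.mem_range] at hi ⊢
    omega
  have hJc : (J.image g).card = J.card := by
    refine Finset.card_image_of_injOn ?_
    intro x hx y hy hxy
    simp only [J, Finset.coe_filter, Finset.mem_range, Set.mem_ofPred_eq] at hx hy
    exact inj0 x y hx.1 hy.1 hxy
  have h1 := Finset.card_le_card hIim
  have h2 := Finset.card_le_card hJim
  rw [hIc, Finset.card_range] at h1
  rw [hJc, Finset.card_range] at h2
  have hI' : I.image (fun i => g (i + 1)) = Finset.range j :=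
    Finset.eq_of_subset_of_card_le hIim (by rw [hIc, Finset.card_range]; omega)
  have hJ' : J.image g = Finset.range (c - j + 1) :=
    Finset.eq_of_subset_of_card_le hJim (by rw [hJc, Finset.card_range]; omega)
  -- successors of middle vertices are middle vertices
  have hsucc : ∀ i < L, (j ≤ g i ∧ g i ≤ c - j) → (j ≤ g (i + 1) ∧ g (i + 1) ≤ c - j) := by
    intro i hi hg
    have ha := hadj i hi
    by_cases hlt : g (i + 1) < j
    · exfalso
      have hm : g (i + 1) ∈ I.image (fun i => g (i + 1)) := by rw [hI']; simpa using hlt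
      obtain ⟨i', hi', he⟩ := Finset.mem_image.1 hm
      simp only [I, Finset.mem_filter, Finset.mem_range] at hi'
      have := inj1 (i' + 1) (i + 1) (by omega) (by omega) (by omega) (by omega) he
      have : i' = i := by omega
      subst this
      omega
    · omega
  have hm : j ∈ J.image g := by rw [hJ']; simp; omega
  obtain ⟨i0, hi0, he0⟩ := Finset.mem_image.1 hm
  simp only [J, Finset.mem_filter, Finset.mem_range] at hi0
  have hup : ∀ d i, i + d ≤ L → (j ≤ g i ∧ g i ≤ c - j) → (j ≤ g (i + d) ∧ g (i + d) ≤ c - j) := by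
    intro d
    induction d with
    | zero => intro i _ h; simpa using h
    | succ d ih =>
      intro i hd h
      exact hsucc (i + d) (by omega) (ih i (by omega) h)
  have hLm := hup (L - i0) i0 (by omega) (by omega)
  rw [show i0 + (L - i0) = L by omega, hclose] at hLm
  have hne : I.Nonempty := Finset.card_pos.1 (by omega)
  obtain ⟨i1, hi1⟩ := hne
  simp only [I, Finset.mem_filter, Finset.mem_range] at hi1
  have := hup i1 0 (by omega) hLm
  rw [zero_add] at this
  omega

theorem fg_circ (n c j : ℕ) (hj2 : 2 ≤ j) (hj : 2 * j ≤ c) (hn : c + 1 ≤ n) :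
    circ (Fgraph n c j) = c := by
  unfold circ
  obtain ⟨v, w, hw, hl⟩ := fg_has_cycle n c j hj2 hj hn
  refine le_antisymm (csSup_le ⟨c, v, w, hw, hl⟩ ?_) (le_csSup (cycle_bdd _) ⟨v, w, hw, hl⟩)
  rintro _ ⟨v, w, hw, rfl⟩
  exact fg_cycle_le n c j hj2 hj v w hw

theorem stmt19 (n c k : ℕ) (h1 : c ≤ n - 1) (h2 : 2 * k ≤ c) (h3 : 2 ≤ k) :
    (∀ (V : Type) (G : SimpleGraph V), Nat.card V = n → TwoConnected G → circ G = c →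
        (∀ v, k ≤ degN G v) →
        edgeCount G ≤ max (fCliques n c k 2) (fCliques n c (c / 2) 2)) ∧
    (∃ G : SimpleGraph (Fin n), TwoConnected G ∧ circ G = c ∧ (∀ v, k ≤ degN G v) ∧
        edgeCount G = max (fCliques n c k 2) (fCliques n c (c / 2) 2)) := by
  refine ⟨fun V G hV hG hc hd => upper_main n c k h1 h2 h3 V G hV hG hc hd, ?_⟩
  have key : ∀ j, k ≤ j → 2 * j ≤ c → ∃ G : SimpleGraph (Fin n), TwoConnected G ∧ circ G = c ∧
      (∀ v, k ≤ degN G v) ∧ edgeCount G = fCliques n c j 2 := fun j hkj hj =>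
    ⟨Fgraph n c j, fg_conn n c j (by omega) hj (by omega), fg_circ n c j (by omega) hj (by omega),
      fun v => hkj.trans (fg_deg n c j hj (by omega) v), fg_edges n c j hj (by omega)⟩
  rcases le_total (fCliques n c k 2) (fCliques n c (c / 2) 2) with h | h
  · rw [max_eq_right h]; exact key _ (by omega) (by omega)
  · rw [max_eq_left h]; exact key _ le_rfl h2
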